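/- In the bounded-coefficient linear model, the objective functional J is strictly concave on the set of square-integrable controls: for any two controls δ = (δ^a, δ^b) and β = (β^a, β^b) that differ on a set of positive dP⊗dt-measure and any λ ∈ (0,1), one has J(λδ + (1−λ)β) > λJ(δ) + (1−λ)J(β). In particular J has at most one maximizer up to dP⊗dt-null modification. -/

import Mathlib

open MeasureTheory

/-- Inventory of the market maker in the linear-intensity macroscopic model:
`Q_t = q₀ − ∫₀ᵗ a_u (ζ − γ δ^a_u) du + ∫₀ᵗ b_u (ζ − γ δ^b_u) du`. -/
noncomputable def inventory {Ω : Type*} (q₀ ζ γ : ℝ)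
    (a b δa δb : ℝ → Ω → ℝ) (t : ℝ) (ω : Ω) : ℝ :=
  q₀ - (∫ u in (0:ℝ)..t, a u ω * (ζ - γ * δa u ω))
    + ∫ u in (0:ℝ)..t, b u ω * (ζ - γ * δb u ω)

/-- Objective functional of the linear-intensity macroscopic market making model:
`J(δ) = E[∫₀ᵀ δ^a a (ζ−γδ^a) dt + ∫₀ᵀ δ^b b (ζ−γδ^b) dt − ∫₀ᵀ φ Q² dt − A Q_T²]`. -/
noncomputable def objective {Ω : Type*} [MeasurableSpace Ω] (P : Measure Ω)
    (T q₀ ζ γ : ℝ) (a b φ : ℝ → Ω → ℝ) (A : Ω → ℝ) (δa δb : ℝ → Ω → ℝ) : ℝ :=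
  ∫ ω, ((∫ t in (0:ℝ)..T, δa t ω * a t ω * (ζ - γ * δa t ω))
      + (∫ t in (0:ℝ)..T, δb t ω * b t ω * (ζ - γ * δb t ω))
      - (∫ t in (0:ℝ)..T, φ t ω * (inventory q₀ ζ γ a b δa δb t ω) ^ 2)
      - A ω * (inventory q₀ ζ γ a b δa δb T ω) ^ 2) ∂P

/-- A square-integrable control: jointly measurable with `E∫₀ᵀ |δ_t|² dt < ∞`. -/
def SquareIntegrableControl {Ω : Type*} [MeasurableSpace Ω] (P : Measure Ω)
    (T : ℝ) (δ : ℝ → Ω → ℝ) : Prop :=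
  Measurable (Function.uncurry δ) ∧
  Integrable (fun p : ℝ × Ω => (δ p.1 p.2) ^ 2)
    ((volume.restrict (Set.Icc 0 T)).prod P)

section LinearModel

variable {Ω : Type*} [MeasurableSpace Ω] {P : Measure Ω} {T : ℝ}

lemma measurable_uncurry_intervalIntegral {F : ℝ → Ω → ℝ}
    (hF : Measurable (Function.uncurry F)) :
    Measurable (fun p : ℝ × Ω => ∫ u in (0:ℝ)..p.1, F u p.2) := by
  have key : ∀ s : Set ((ℝ × Ω) × ℝ), MeasurableSet s →
      Measurable (fun p : ℝ × Ω => ∫ u, s.indicator (fun q => F q.2 q.1.2) (p, u)) := by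
    intro s hs
    have h1 : Measurable (fun q : (ℝ × Ω) × ℝ => F q.2 q.1.2) :=
      hF.comp (measurable_snd.prodMk (measurable_snd.comp measurable_fst))
    exact (h1.indicator hs).stronglyMeasurable.integral_prod_right'.measurable
  have hpos : MeasurableSet {q : (ℝ × Ω) × ℝ | 0 < q.2 ∧ q.2 ≤ q.1.1} :=
    (measurableSet_lt measurable_const measurable_snd).inter
      (measurableSet_le measurable_snd (measurable_fst.comp measurable_fst))
  have hneg : MeasurableSet {q : (ℝ × Ω) × ℝ | q.1.1 < q.2 ∧ q.2 ≤ 0} :=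
    (measurableSet_lt (measurable_fst.comp measurable_fst) measurable_snd).inter
      (measurableSet_le measurable_snd measurable_const)
  convert (key _ hpos).sub (key _ hneg) using 2 with p
  simp only [intervalIntegral]
  rw [← integral_indicator measurableSet_Ioc, ← integral_indicator measurableSet_Ioc]
  rfl

lemma intervalIntegral_eq_integral_restrict_Icc (hT : 0 ≤ T) (f : ℝ → ℝ) :
    ∫ t in (0:ℝ)..T, f t = ∫ t, f t ∂(volume.restrict (Set.Icc 0 T)) := by
  rw [intervalIntegral.integral_of_le hT, integral_Icc_eq_integral_Ioc]

lemma sq_intervalIntegral_le {f : ℝ → ℝ}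
    (hf : Integrable f (volume.restrict (Set.Icc 0 T)))
    (hf2 : Integrable (fun u => f u ^ 2) (volume.restrict (Set.Icc 0 T)))
    {t : ℝ} (ht : t ∈ Set.Icc 0 T) :
    (∫ u in (0:ℝ)..t, f u) ^ 2 ≤ T * ∫ u, f u ^ 2 ∂(volume.restrict (Set.Icc 0 T)) := by
  have hle : volume.restrict (Set.Icc 0 t) ≤ volume.restrict (Set.Icc (0:ℝ) T) :=
    Measure.restrict_mono (Set.Icc_subset_Icc_right ht.2) le_rfl
  have hft := hf.mono_measure hle
  have hft2 := hf2.mono_measure hle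
  have hmono : ∫ u, f u ^ 2 ∂(volume.restrict (Set.Icc 0 t))
      ≤ ∫ u, f u ^ 2 ∂(volume.restrict (Set.Icc 0 T)) :=
    integral_mono_measure hle (Filter.Eventually.of_forall fun u => sq_nonneg (f u)) hf2
  have hnn : 0 ≤ ∫ u, f u ^ 2 ∂(volume.restrict (Set.Icc 0 t)) :=
    integral_nonneg fun u => sq_nonneg (f u)
  rw [intervalIntegral_eq_integral_restrict_Icc ht.1]
  set I := ∫ u, f u ∂(volume.restrict (Set.Icc 0 t)) with hI
  set S := ∫ u, f u ^ 2 ∂(volume.restrict (Set.Icc 0 t)) with hS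
  have hquad : 0 ≤ t ^ 2 * S - 2 * t * I * I + I ^ 2 * t := by
    have h0 : 0 ≤ ∫ u, (t * f u - I) ^ 2 ∂(volume.restrict (Set.Icc 0 t)) :=
      integral_nonneg fun u => sq_nonneg _
    have heq : ∫ u, (t * f u - I) ^ 2 ∂(volume.restrict (Set.Icc 0 t))
        = t ^ 2 * S - 2 * t * I * I + I ^ 2 * t := by
      have : ∀ u, (t * f u - I) ^ 2 = t ^ 2 * f u ^ 2 - 2 * t * I * f u + I ^ 2 := fun u => by ring
      simp_rw [this]
      have hdiff : Integrable (fun u => t ^ 2 * f u ^ 2 - 2 * t * I * f u)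
          (volume.restrict (Set.Icc 0 t)) := (hft2.const_mul _).sub (hft.const_mul _)
      rw [integral_add hdiff (integrable_const _),
        integral_sub (hft2.const_mul _) (hft.const_mul _), integral_const_mul,
        integral_const_mul, integral_const, ← hI, ← hS]
      simp [ht.1, mul_comm]
    linarith
  have hIS : I ^ 2 ≤ t * S := by
    rcases ht.1.eq_or_lt with h | h
    · have : I = 0 := by rw [hI, ← h]; simp
      rw [this, ← h]; simp
    · have : 0 ≤ t * (t * S - I ^ 2) := by nlinarith
      have := nonneg_of_mul_nonneg_right this h
      linarith
  calc I ^ 2 ≤ t * S := hIS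
    _ ≤ T * _ := mul_le_mul ht.2 hmono hnn (ht.1.trans ht.2)

lemma SquareIntegrableControl.memLp {F : ℝ → Ω → ℝ} (hF : SquareIntegrableControl P T F) :
    MemLp (fun p : ℝ × Ω => F p.1 p.2) 2 ((volume.restrict (Set.Icc 0 T)).prod P) :=
  (memLp_two_iff_integrable_sq hF.1.aestronglyMeasurable).2 hF.2

lemma squareIntegrableControl_of_memLp {F : ℝ → Ω → ℝ} (hF : Measurable (Function.uncurry F))
    (h : MemLp (fun p : ℝ × Ω => F p.1 p.2) 2 ((volume.restrict (Set.Icc 0 T)).prod P)) :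
    SquareIntegrableControl P T F :=
  ⟨hF, h.integrable_sq⟩

lemma SquareIntegrableControl.convexComb {F G : ℝ → Ω → ℝ} (hF : SquareIntegrableControl P T F)
    (hG : SquareIntegrableControl P T G) (c d : ℝ) :
    SquareIntegrableControl P T (fun t ω => c * F t ω + d * G t ω) :=
  squareIntegrableControl_of_memLp ((hF.1.const_mul c).add (hG.1.const_mul d))
    ((hF.memLp.const_mul c).add (hG.memLp.const_mul d))

lemma memLp_two_weight_mul {X : Type*} [MeasurableSpace X] {ν : Measure X} {w f : X → ℝ} {C : ℝ}
    (hw : Measurable w) (hC : ∀ x, 0 ≤ w x ∧ w x ≤ C) (hf : MemLp f 2 ν) :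
    MemLp (fun x => w x * f x) 2 ν := by
  refine hf.of_le_mul (c := C) (hw.aestronglyMeasurable.mul hf.1)
    (Filter.Eventually.of_forall fun x => ?_)
  rw [norm_mul, Real.norm_of_nonneg (hC x).1]
  exact mul_le_mul_of_nonneg_right (hC x).2 (norm_nonneg _)

lemma integrable_weight_mul_sq {X : Type*} [MeasurableSpace X] {ν : Measure X} {w f : X → ℝ}
    {C : ℝ} (hw : Measurable w) (hC : ∀ x, 0 ≤ w x ∧ w x ≤ C) (hf : MemLp f 2 ν) :
    Integrable (fun x => w x * f x ^ 2) ν := by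
  refine ((memLp_two_weight_mul hw hC hf).integrable_mul hf).congr
    (Filter.Eventually.of_forall fun x => ?_)
  simp only [Pi.mul_apply]
  ring

lemma SquareIntegrableControl.rate [IsFiniteMeasure P] {a F : ℝ → Ω → ℝ} {C : ℝ}
    (ζ γ : ℝ) (ha : Measurable (Function.uncurry a)) (hC : ∀ t ω, 0 < a t ω ∧ a t ω ≤ C)
    (hF : SquareIntegrableControl P T F) :
    SquareIntegrableControl P T (fun t ω => a t ω * (ζ - γ * F t ω)) :=
  squareIntegrableControl_of_memLp (ha.mul (measurable_const.sub (hF.1.const_mul γ)))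
    (memLp_two_weight_mul (w := fun p : ℝ × Ω => a p.1 p.2) ha
      (fun p => ⟨(hC p.1 p.2).1.le, (hC p.1 p.2).2⟩)
      ((memLp_const ζ).sub (hF.memLp.const_mul γ)))

lemma SquareIntegrableControl.ae_integrable [IsFiniteMeasure P] {F : ℝ → Ω → ℝ}
    (hF : SquareIntegrableControl P T F) :
    ∀ᵐ ω ∂P, Integrable (fun t => F t ω) (volume.restrict (Set.Icc 0 T)) :=
  (hF.memLp.integrable one_le_two).prod_left_ae

lemma SquareIntegrableControl.ae_sq_intervalIntegral_le [IsFiniteMeasure P] {F : ℝ → Ω → ℝ}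
    (hF : SquareIntegrableControl P T F) :
    ∀ᵐ ω ∂P, ∀ t ∈ Set.Icc 0 T, (∫ u in (0:ℝ)..t, F u ω) ^ 2
      ≤ T * ∫ u, F u ω ^ 2 ∂(volume.restrict (Set.Icc 0 T)) := by
  filter_upwards [hF.ae_integrable, hF.2.prod_left_ae] with ω h1 h2 t ht
  exact sq_intervalIntegral_le h1 h2 ht

lemma ae_prod_of_ae_forall_mem [SFinite P] {p : ℝ → Ω → Prop}
    (h : ∀ᵐ ω ∂P, ∀ t ∈ Set.Icc 0 T, p t ω) :
    ∀ᵐ x ∂((volume.restrict (Set.Icc 0 T)).prod P), p x.1 x.2 := by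
  filter_upwards [Measure.quasiMeasurePreserving_snd.ae h,
    Measure.quasiMeasurePreserving_fst.ae (ae_restrict_mem measurableSet_Icc)] with x h1 h2
  exact h1 x.1 h2

lemma SquareIntegrableControl.intervalIntegral [IsFiniteMeasure P] {F : ℝ → Ω → ℝ}
    (hF : SquareIntegrableControl P T F) :
    SquareIntegrableControl P T (fun t ω => ∫ u in (0:ℝ)..t, F u ω) := by
  have hm := measurable_uncurry_intervalIntegral hF.1
  refine ⟨hm, ?_⟩
  refine ((hF.2.integral_prod_right.const_mul T).comp_snd
    (volume.restrict (Set.Icc 0 T))).mono' (hm.pow_const 2).aestronglyMeasurable ?_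
  filter_upwards [ae_prod_of_ae_forall_mem hF.ae_sq_intervalIntegral_le] with x hx
  rw [Real.norm_of_nonneg (sq_nonneg _)]
  exact hx

lemma SquareIntegrableControl.memLp_intervalIntegral_terminal [IsFiniteMeasure P]
    {F : ℝ → Ω → ℝ} (hT : 0 ≤ T) (hF : SquareIntegrableControl P T F) :
    MemLp (fun ω => ∫ u in (0:ℝ)..T, F u ω) 2 P := by
  have hm : Measurable (fun ω => ∫ u in (0:ℝ)..T, F u ω) :=
    (measurable_uncurry_intervalIntegral hF.1).comp (measurable_const.prodMk measurable_id)
  refine (memLp_two_iff_integrable_sq hm.aestronglyMeasurable).2 ?_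
  refine (hF.2.integral_prod_right.const_mul T).mono' (hm.pow_const 2).aestronglyMeasurable ?_
  filter_upwards [hF.ae_sq_intervalIntegral_le] with ω hω
  rw [Real.norm_of_nonneg (sq_nonneg _)]
  exact hω T ⟨hT, le_rfl⟩

lemma integral_weight_mul_sq_convexComb_le {X : Type*} [MeasurableSpace X] {ν : Measure X}
    {w f g h : X → ℝ} {C : ℝ} (hw : Measurable w) (hC : ∀ x, 0 ≤ w x ∧ w x ≤ C)
    (hf : MemLp f 2 ν) (hg : MemLp g 2 ν) {lam : ℝ} (h0 : 0 ≤ lam) (h1 : lam ≤ 1)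
    (hh : ∀ᵐ x ∂ν, h x = lam * f x + (1 - lam) * g x) :
    ∫ x, w x * h x ^ 2 ∂ν
      ≤ lam * ∫ x, w x * f x ^ 2 ∂ν + (1 - lam) * ∫ x, w x * g x ^ 2 ∂ν := by
  have hif := (integrable_weight_mul_sq hw hC hf).const_mul lam
  have hig := (integrable_weight_mul_sq hw hC hg).const_mul (1 - lam)
  have hhL : MemLp h 2 ν := ((hf.const_mul lam).add (hg.const_mul (1 - lam))).ae_eq
    (by filter_upwards [hh] with x hx; simp [hx])
  rw [← integral_const_mul, ← integral_const_mul, ← integral_add hif hig]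
  refine integral_mono_ae (integrable_weight_mul_sq hw hC hhL) (hif.add hig) ?_
  filter_upwards [hh] with x hx
  simp only [hx]
  nlinarith [mul_nonneg (mul_nonneg (hC x).1 (mul_nonneg h0 (sub_nonneg.2 h1)))
    (sq_nonneg (f x - g x))]

lemma integrable_revenue {X : Type*} [MeasurableSpace X] {ν : Measure X} [IsFiniteMeasure ν]
    {w f : X → ℝ} {C : ℝ} (ζ γ : ℝ) (hw : Measurable w) (hC : ∀ x, 0 < w x ∧ w x ≤ C)
    (hf : MemLp f 2 ν) : Integrable (fun x => f x * w x * (ζ - γ * f x)) ν := by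
  refine (hf.integrable_mul (memLp_two_weight_mul hw (fun x => ⟨(hC x).1.le, (hC x).2⟩)
    ((memLp_const ζ).sub (hf.const_mul γ)))).congr (Filter.Eventually.of_forall fun x => ?_)
  simp only [Pi.mul_apply, Pi.sub_apply]
  ring

lemma integral_revenue_convexComb {X : Type*} [MeasurableSpace X] {ν : Measure X}
    [IsFiniteMeasure ν] {w f g : X → ℝ} {C : ℝ} (ζ γ : ℝ) (hw : Measurable w)
    (hC : ∀ x, 0 < w x ∧ w x ≤ C) (hf : MemLp f 2 ν) (hg : MemLp g 2 ν) (lam : ℝ) :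
    ∫ x, (lam * f x + (1 - lam) * g x) * w x * (ζ - γ * (lam * f x + (1 - lam) * g x)) ∂ν
      = lam * ∫ x, f x * w x * (ζ - γ * f x) ∂ν + (1 - lam) * ∫ x, g x * w x * (ζ - γ * g x) ∂ν
        + lam * (1 - lam) * γ * ∫ x, w x * (f x - g x) ^ 2 ∂ν := by
  have hif := (integrable_revenue ζ γ hw hC hf).const_mul lam
  have hig := (integrable_revenue ζ γ hw hC hg).const_mul (1 - lam)
  have hd : Integrable (fun x => w x * (f x - g x) ^ 2) ν :=
    integrable_weight_mul_sq hw (fun x => ⟨(hC x).1.le, (hC x).2⟩) (hf.sub hg)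
  have hsum : Integrable (fun x => lam * (f x * w x * (ζ - γ * f x))
      + (1 - lam) * (g x * w x * (ζ - γ * g x))) ν := hif.add hig
  rw [← integral_const_mul, ← integral_const_mul, ← integral_const_mul, ← integral_add hif hig,
    ← integral_add hsum (hd.const_mul _)]
  congr 1
  ext x
  ring

lemma integral_weight_mul_sq_sub_pos {X : Type*} [MeasurableSpace X] {ν : Measure X}
    {w f g : X → ℝ} {C : ℝ} (hw : Measurable w) (hC : ∀ x, 0 < w x ∧ w x ≤ C)
    (hf : MemLp f 2 ν) (hg : MemLp g 2 ν) (hne : ¬ f =ᵐ[ν] g) :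
    0 < ∫ x, w x * (f x - g x) ^ 2 ∂ν := by
  have hnn : 0 ≤ fun x => w x * (f x - g x) ^ 2 :=
    fun x => mul_nonneg (hC x).1.le (sq_nonneg _)
  refine (integral_nonneg hnn).lt_of_ne' fun h => hne ?_
  have hd : Integrable (fun x => w x * (f x - g x) ^ 2) ν :=
    integrable_weight_mul_sq hw (fun x => ⟨(hC x).1.le, (hC x).2⟩) (hf.sub hg)
  filter_upwards [(integral_eq_zero_iff_of_nonneg hnn hd).1 h] with x hx
  have hx' : w x * (f x - g x) ^ 2 = 0 := hx
  rcases mul_eq_zero.1 hx' with h' | h'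
  · exact absurd h' (hC x).1.ne'
  · exact sub_eq_zero.1 (pow_eq_zero_iff two_ne_zero |>.1 h')

section Inventory

variable [IsFiniteMeasure P] {q₀ ζ γ abar bbar : ℝ} {a b δa δb βa βb : ℝ → Ω → ℝ}

lemma memLp_inventory (ha : Measurable (Function.uncurry a)) (hb : Measurable (Function.uncurry b))
    (hA : ∀ t ω, 0 < a t ω ∧ a t ω ≤ abar) (hB : ∀ t ω, 0 < b t ω ∧ b t ω ≤ bbar)
    (hδa : SquareIntegrableControl P T δa) (hδb : SquareIntegrableControl P T δb) :
    MemLp (fun p : ℝ × Ω => inventory q₀ ζ γ a b δa δb p.1 p.2) 2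
      ((volume.restrict (Set.Icc 0 T)).prod P) :=
  ((memLp_const q₀).sub (hδa.rate ζ γ ha hA).intervalIntegral.memLp).add
    (hδb.rate ζ γ hb hB).intervalIntegral.memLp

lemma memLp_inventory_terminal (hT : 0 ≤ T) (ha : Measurable (Function.uncurry a))
    (hb : Measurable (Function.uncurry b))
    (hA : ∀ t ω, 0 < a t ω ∧ a t ω ≤ abar) (hB : ∀ t ω, 0 < b t ω ∧ b t ω ≤ bbar)
    (hδa : SquareIntegrableControl P T δa) (hδb : SquareIntegrableControl P T δb) :
    MemLp (fun ω => inventory q₀ ζ γ a b δa δb T ω) 2 P :=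
  ((memLp_const q₀).sub ((hδa.rate ζ γ ha hA).memLp_intervalIntegral_terminal hT)).add
    ((hδb.rate ζ γ hb hB).memLp_intervalIntegral_terminal hT)

lemma ae_intervalIntegral_rate_convexComb (ha : Measurable (Function.uncurry a))
    (hA : ∀ t ω, 0 < a t ω ∧ a t ω ≤ abar)
    (hδa : SquareIntegrableControl P T δa) (hβa : SquareIntegrableControl P T βa) (lam : ℝ) :
    ∀ᵐ ω ∂P, ∀ t ∈ Set.Icc 0 T,
      ∫ u in (0:ℝ)..t, a u ω * (ζ - γ * (lam * δa u ω + (1 - lam) * βa u ω))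
        = lam * (∫ u in (0:ℝ)..t, a u ω * (ζ - γ * δa u ω))
          + (1 - lam) * ∫ u in (0:ℝ)..t, a u ω * (ζ - γ * βa u ω) := by
  filter_upwards [(hδa.rate ζ γ ha hA).ae_integrable, (hβa.rate ζ γ ha hA).ae_integrable]
    with ω h1 h2 t ht
  have hle : volume.restrict (Set.Icc 0 t) ≤ volume.restrict (Set.Icc (0:ℝ) T) :=
    Measure.restrict_mono (Set.Icc_subset_Icc_right ht.2) le_rfl
  simp only [intervalIntegral_eq_integral_restrict_Icc ht.1]
  rw [← integral_const_mul, ← integral_const_mul,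
    ← integral_add ((h1.mono_measure hle).const_mul _) ((h2.mono_measure hle).const_mul _)]
  congr 1
  ext u
  ring

lemma ae_inventory_convexComb (ha : Measurable (Function.uncurry a))
    (hb : Measurable (Function.uncurry b))
    (hA : ∀ t ω, 0 < a t ω ∧ a t ω ≤ abar) (hB : ∀ t ω, 0 < b t ω ∧ b t ω ≤ bbar)
    (hδa : SquareIntegrableControl P T δa) (hδb : SquareIntegrableControl P T δb)
    (hβa : SquareIntegrableControl P T βa) (hβb : SquareIntegrableControl P T βb) (lam : ℝ) :
    ∀ᵐ ω ∂P, ∀ t ∈ Set.Icc 0 T,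
      inventory q₀ ζ γ a b (fun t ω => lam * δa t ω + (1 - lam) * βa t ω)
          (fun t ω => lam * δb t ω + (1 - lam) * βb t ω) t ω
        = lam * inventory q₀ ζ γ a b δa δb t ω
          + (1 - lam) * inventory q₀ ζ γ a b βa βb t ω := by
  filter_upwards [ae_intervalIntegral_rate_convexComb (ζ := ζ) (γ := γ) ha hA hδa hβa lam,
    ae_intervalIntegral_rate_convexComb (ζ := ζ) (γ := γ) hb hB hδb hβb lam] with ω h1 h2 t ht
  simp only [inventory, h1 t ht, h2 t ht]
  ring

lemma objective_eq_integral_prod {φ : ℝ → Ω → ℝ} {A : Ω → ℝ} {φbar Abar : ℝ} (hT : 0 ≤ T)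
    (ha : Measurable (Function.uncurry a)) (hb : Measurable (Function.uncurry b))
    (hφ : Measurable (Function.uncurry φ)) (hA : Measurable A)
    (haB : ∀ t ω, 0 < a t ω ∧ a t ω ≤ abar) (hbB : ∀ t ω, 0 < b t ω ∧ b t ω ≤ bbar)
    (hφB : ∀ t ω, 0 ≤ φ t ω ∧ φ t ω ≤ φbar) (hAB : ∀ ω, 0 ≤ A ω ∧ A ω ≤ Abar)
    (hδa : SquareIntegrableControl P T δa) (hδb : SquareIntegrableControl P T δb) :
    objective P T q₀ ζ γ a b φ A δa δb
      = (∫ p : ℝ × Ω, δa p.1 p.2 * a p.1 p.2 * (ζ - γ * δa p.1 p.2)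
            ∂((volume.restrict (Set.Icc 0 T)).prod P))
        + (∫ p : ℝ × Ω, δb p.1 p.2 * b p.1 p.2 * (ζ - γ * δb p.1 p.2)
            ∂((volume.restrict (Set.Icc 0 T)).prod P))
        - (∫ p : ℝ × Ω, φ p.1 p.2 * inventory q₀ ζ γ a b δa δb p.1 p.2 ^ 2
            ∂((volume.restrict (Set.Icc 0 T)).prod P))
        - ∫ ω, A ω * inventory q₀ ζ γ a b δa δb T ω ^ 2 ∂P := by
  have ia := integrable_revenue (w := fun p : ℝ × Ω => a p.1 p.2) ζ γ ha
    (fun p => haB p.1 p.2) hδa.memLp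
  have ib := integrable_revenue (w := fun p : ℝ × Ω => b p.1 p.2) ζ γ hb
    (fun p => hbB p.1 p.2) hδb.memLp
  have iφ := integrable_weight_mul_sq (w := fun p : ℝ × Ω => φ p.1 p.2) hφ
    (fun p => hφB p.1 p.2) (memLp_inventory (q₀ := q₀) (ζ := ζ) (γ := γ) ha hb haB hbB hδa hδb)
  have iA := integrable_weight_mul_sq hA hAB
    (memLp_inventory_terminal (q₀ := q₀) (ζ := ζ) (γ := γ) hT ha hb haB hbB hδa hδb)
  rw [integral_prod_symm _ ia, integral_prod_symm _ ib, integral_prod_symm _ iφ]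
  simp only [objective, intervalIntegral_eq_integral_restrict_Icc hT]
  have iab : Integrable (fun ω =>
      (∫ t, δa t ω * a t ω * (ζ - γ * δa t ω) ∂(volume.restrict (Set.Icc 0 T)))
        + ∫ t, δb t ω * b t ω * (ζ - γ * δb t ω) ∂(volume.restrict (Set.Icc 0 T))) P :=
    ia.integral_prod_right.add ib.integral_prod_right
  have iabφ : Integrable (fun ω =>
      (∫ t, δa t ω * a t ω * (ζ - γ * δa t ω) ∂(volume.restrict (Set.Icc 0 T)))
        + (∫ t, δb t ω * b t ω * (ζ - γ * δb t ω) ∂(volume.restrict (Set.Icc 0 T)))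
        - ∫ t, φ t ω * inventory q₀ ζ γ a b δa δb t ω ^ 2
            ∂(volume.restrict (Set.Icc 0 T))) P :=
    iab.sub iφ.integral_prod_right
  rw [integral_sub iabφ iA, integral_sub iab iφ.integral_prod_right,
    integral_add ia.integral_prod_right ib.integral_prod_right]

end Inventory

end LinearModel

/-- **Strict concavity of the objective functional in the bounded-coefficient linear
model.** If two square-integrable controls differ on a set of positive `dP⊗dt`-measure,
then `J` is strictly concave along the segment joining them; consequently `J` has at
most one maximizer up to `dP⊗dt`-null modification. -/
theorem objective_strictly_concave
    {Ω : Type*} [MeasurableSpace Ω] (P : Measure Ω) [IsProbabilityMeasure P]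
    (T ζ γ q₀ : ℝ) (hT : 0 < T) (hζ : 0 < ζ) (hγ : 0 < γ)
    (a b φ : ℝ → Ω → ℝ) (A : Ω → ℝ)
    (abar bbar φbar Abar : ℝ)
    (hameas : Measurable (Function.uncurry a))
    (hbmeas : Measurable (Function.uncurry b))
    (hφmeas : Measurable (Function.uncurry φ))
    (hAmeas : Measurable A)
    (ha : ∀ t ω, 0 < a t ω ∧ a t ω ≤ abar)
    (hb : ∀ t ω, 0 < b t ω ∧ b t ω ≤ bbar)
    (hφ : ∀ t ω, 0 ≤ φ t ω ∧ φ t ω ≤ φbar)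
    (hA : ∀ ω, 0 ≤ A ω ∧ A ω ≤ Abar) :
    -- strict concavity along segments between controls differing on positive measure
    (∀ δa δb βa βb : ℝ → Ω → ℝ,
      SquareIntegrableControl P T δa → SquareIntegrableControl P T δb →
      SquareIntegrableControl P T βa → SquareIntegrableControl P T βb →
      ((volume.restrict (Set.Icc (0:ℝ) T)).prod P)
        {p : ℝ × Ω | (δa p.1 p.2, δb p.1 p.2) ≠ (βa p.1 p.2, βb p.1 p.2)} ≠ 0 →
      ∀ lam : ℝ, 0 < lam → lam < 1 →
        lam * objective P T q₀ ζ γ a b φ A δa δb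
            + (1 - lam) * objective P T q₀ ζ γ a b φ A βa βb
          < objective P T q₀ ζ γ a b φ A
              (fun t ω => lam * δa t ω + (1 - lam) * βa t ω)
              (fun t ω => lam * δb t ω + (1 - lam) * βb t ω)) ∧
    -- uniqueness of the maximizer up to dP⊗dt-null modification
    (∀ δa δb βa βb : ℝ → Ω → ℝ,
      SquareIntegrableControl P T δa → SquareIntegrableControl P T δb →
      SquareIntegrableControl P T βa → SquareIntegrableControl P T βb →
      (∀ αa αb : ℝ → Ω → ℝ, SquareIntegrableControl P T αa →
        SquareIntegrableControl P T αb →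
        objective P T q₀ ζ γ a b φ A αa αb ≤ objective P T q₀ ζ γ a b φ A δa δb) →
      (∀ αa αb : ℝ → Ω → ℝ, SquareIntegrableControl P T αa →
        SquareIntegrableControl P T αb →
        objective P T q₀ ζ γ a b φ A αa αb ≤ objective P T q₀ ζ γ a b φ A βa βb) →
      ((volume.restrict (Set.Icc (0:ℝ) T)).prod P)
        {p : ℝ × Ω | (δa p.1 p.2, δb p.1 p.2) ≠ (βa p.1 p.2, βb p.1 p.2)} = 0) := by
  have hconc : ∀ δa δb βa βb : ℝ → Ω → ℝ,
      SquareIntegrableControl P T δa → SquareIntegrableControl P T δb →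
      SquareIntegrableControl P T βa → SquareIntegrableControl P T βb →
      ((volume.restrict (Set.Icc (0:ℝ) T)).prod P)
        {p : ℝ × Ω | (δa p.1 p.2, δb p.1 p.2) ≠ (βa p.1 p.2, βb p.1 p.2)} ≠ 0 →
      ∀ lam : ℝ, 0 < lam → lam < 1 →
        lam * objective P T q₀ ζ γ a b φ A δa δb
            + (1 - lam) * objective P T q₀ ζ γ a b φ A βa βb
          < objective P T q₀ ζ γ a b φ A
              (fun t ω => lam * δa t ω + (1 - lam) * βa t ω)
              (fun t ω => lam * δb t ω + (1 - lam) * βb t ω) := by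
    intro δa δb βa βb hδa hδb hβa hβb hne lam h0 h1
    have hmix := ae_inventory_convexComb (q₀ := q₀) (ζ := ζ) (γ := γ) hameas hbmeas ha hb
      hδa hδb hβa hβb lam
    rw [objective_eq_integral_prod hT.le hameas hbmeas hφmeas hAmeas ha hb hφ hA hδa hδb,
      objective_eq_integral_prod hT.le hameas hbmeas hφmeas hAmeas ha hb hφ hA hβa hβb,
      objective_eq_integral_prod hT.le hameas hbmeas hφmeas hAmeas ha hb hφ hA
        (hδa.convexComb hβa lam (1 - lam)) (hδb.convexComb hβb lam (1 - lam)),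
      integral_revenue_convexComb (w := fun p : ℝ × Ω => a p.1 p.2) ζ γ hameas
        (fun p => ha p.1 p.2) hδa.memLp hβa.memLp lam,
      integral_revenue_convexComb (w := fun p : ℝ × Ω => b p.1 p.2) ζ γ hbmeas
        (fun p => hb p.1 p.2) hδb.memLp hβb.memLp lam]
    have hrun := integral_weight_mul_sq_convexComb_le (w := fun p : ℝ × Ω => φ p.1 p.2) hφmeas
      (fun p => hφ p.1 p.2)
      (memLp_inventory (q₀ := q₀) (ζ := ζ) (γ := γ) hameas hbmeas ha hb hδa hδb)
      (memLp_inventory (q₀ := q₀) (ζ := ζ) (γ := γ) hameas hbmeas ha hb hβa hβb)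
      h0.le h1.le (ae_prod_of_ae_forall_mem hmix)
    have hterm := integral_weight_mul_sq_convexComb_le hAmeas hA
      (memLp_inventory_terminal (q₀ := q₀) (ζ := ζ) (γ := γ) hT.le hameas hbmeas ha hb hδa hδb)
      (memLp_inventory_terminal (q₀ := q₀) (ζ := ζ) (γ := γ) hT.le hameas hbmeas ha hb hβa hβb)
      h0.le h1.le (hmix.mono fun ω h => h T ⟨hT.le, le_rfl⟩)
    have hgap : 0 < (∫ p : ℝ × Ω, a p.1 p.2 * (δa p.1 p.2 - βa p.1 p.2) ^ 2
          ∂((volume.restrict (Set.Icc 0 T)).prod P))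
        + ∫ p : ℝ × Ω, b p.1 p.2 * (δb p.1 p.2 - βb p.1 p.2) ^ 2
          ∂((volume.restrict (Set.Icc 0 T)).prod P) := by
      have hna : 0 ≤ ∫ p : ℝ × Ω, a p.1 p.2 * (δa p.1 p.2 - βa p.1 p.2) ^ 2
          ∂((volume.restrict (Set.Icc 0 T)).prod P) :=
        integral_nonneg fun p => mul_nonneg (ha p.1 p.2).1.le (sq_nonneg _)
      have hnb : 0 ≤ ∫ p : ℝ × Ω, b p.1 p.2 * (δb p.1 p.2 - βb p.1 p.2) ^ 2
          ∂((volume.restrict (Set.Icc 0 T)).prod P) :=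
        integral_nonneg fun p => mul_nonneg (hb p.1 p.2).1.le (sq_nonneg _)
      by_cases hea : (fun p : ℝ × Ω => δa p.1 p.2)
          =ᵐ[(volume.restrict (Set.Icc 0 T)).prod P] fun p => βa p.1 p.2
      · by_cases heb : (fun p : ℝ × Ω => δb p.1 p.2)
            =ᵐ[(volume.restrict (Set.Icc 0 T)).prod P] fun p => βb p.1 p.2
        · refine absurd (ae_iff.1 ?_) hne
          filter_upwards [hea, heb] with p h h'
          exact Prod.ext h h'
        · exact add_pos_of_nonneg_of_pos hna (integral_weight_mul_sq_sub_pos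
            (w := fun p : ℝ × Ω => b p.1 p.2) hbmeas (fun p => hb p.1 p.2)
            hδb.memLp hβb.memLp heb)
      · exact add_pos_of_pos_of_nonneg (integral_weight_mul_sq_sub_pos
          (w := fun p : ℝ × Ω => a p.1 p.2) hameas (fun p => ha p.1 p.2)
          hδa.memLp hβa.memLp hea) hnb
    have hpos := mul_pos (mul_pos (mul_pos h0 (sub_pos.2 h1)) hγ) hgap
    linarith
  refine ⟨hconc, fun δa δb βa βb hδa hδb hβa hβb hδmax hβmax => ?_⟩
  by_contra hne
  have hlt := hconc δa δb βa βb hδa hδb hβa hβb hne (1 / 2) (by norm_num) (by norm_num)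
  have ha' := hδa.convexComb hβa (1 / 2) (1 - 1 / 2)
  have hb' := hδb.convexComb hβb (1 / 2) (1 - 1 / 2)
  have h1 := hδmax _ _ ha' hb'
  have h2 := hβmax _ _ ha' hb'
  linarith
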